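/- For every α, ℓ > 0, every n ≥ 1 and every integer q ≥ 1, |I_α(φ_{ℓ,2q}) − Q_{α,ℓ,n}^{GH}(φ_{ℓ,2q})| ≤ C_q^{−1} (β/α) (β²/ℓ²)^q q^{−1/4}, where β = αℓ/√(α² + ℓ²). -/

import Mathlib

open MeasureTheory Real Filter

noncomputable section

/-- The orthonormal basis functions of the Gaussian RKHS. -/
def phi (ℓ : ℝ) (m : ℕ) (x : ℝ) : ℝ :=
  x ^ m * Real.exp (-x ^ 2 / (2 * ℓ ^ 2)) / (ℓ ^ m * Real.sqrt (Nat.factorial m))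

/-- The univariate Gaussian integral functional. -/
def Igauss (α : ℝ) (f : ℝ → ℝ) : ℝ :=
  (Real.sqrt (2 * Real.pi) * α)⁻¹ * ∫ x : ℝ, f x * Real.exp (-x ^ 2 / (2 * α ^ 2))

/-- β = αℓ/√(α² + ℓ²). -/
def betaP (α ℓ : ℝ) : ℝ := α * ℓ / Real.sqrt (α ^ 2 + ℓ ^ 2)

/-- C_n = 2^n n! n^{−1/4} / √((2n)!). -/
def Cseq (n : ℕ) : ℝ :=
  2 ^ n * (Nat.factorial n : ℝ) * (n : ℝ) ^ (-(1 / 4 : ℝ)) / Real.sqrt (Nat.factorial (2 * n))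

/-- ω_γ = 2γ²/(1 + 2γ² + √(1+4γ²)). -/
def omegaP (γ : ℝ) : ℝ := 2 * γ ^ 2 / (1 + 2 * γ ^ 2 + Real.sqrt (1 + 4 * γ ^ 2))

/-- C̄_n(γ). -/
def Cbar (γ : ℝ) (n : ℕ) : ℝ :=
  Real.sqrt (2 * (1 + 4 * γ ^ 2) ^ ((1 : ℝ) / 4) /
      ((1 + 2 * γ ^ 2 + Real.sqrt (1 + 4 * γ ^ 2)) * Real.exp 1)) *
    ((Nat.factorial n : ℝ) / (Nat.factorial (2 * n) : ℝ)) *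
    (Real.exp 1 / (4 * (n : ℝ))) ^ (-(n : ℤ))

/-- `x`, `w` are the nodes and weights of the n-point Gauss–Hermite rule: the nodes are the
n distinct roots of the probabilists' Hermite polynomial H_n, the weights are positive, and
the rule integrates exactly all polynomials of degree at most 2n−1 against the standard
Gaussian weight. -/
def IsGaussHermite (n : ℕ) (x w : Fin n → ℝ) : Prop :=
  Function.Injective x ∧
  (∀ i, Polynomial.aeval (x i) (Polynomial.hermite n) = 0) ∧
  (∀ i, 0 < w i) ∧
  ∀ p : Polynomial ℝ, p.natDegree ≤ 2 * n - 1 →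
    ∑ i, w i * p.eval (x i)
      = (Real.sqrt (2 * Real.pi))⁻¹ * ∫ t : ℝ, p.eval t * Real.exp (-t ^ 2 / 2)

/-- The scaled Gauss–Hermite rule Q_{α,ℓ,n}^{GH}. -/
def QGH (α ℓ : ℝ) {n : ℕ} (x w : Fin n → ℝ) (f : ℝ → ℝ) : ℝ :=
  betaP α ℓ / α *
    ∑ i, w i * Real.exp (betaP α ℓ ^ 2 * x i ^ 2 / (2 * ℓ ^ 2)) * f (betaP α ℓ * x i)

/-- Membership in the unit ball of the Gaussian RKHS H(K_ℓ). -/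
def InBall (ℓ : ℝ) (f : ℝ → ℝ) : Prop :=
  ∃ c : ℕ → ℝ, (∀ x, HasSum (fun m => c m * phi ℓ m x) (f x)) ∧
    Summable (fun m => c m ^ 2) ∧ (∑' m, c m ^ 2) ≤ 1

/-- Worst-case error of a quadrature functional over the unit ball of H(K_ℓ). -/
def wce1 (α ℓ : ℝ) (Q : (ℝ → ℝ) → ℝ) : ℝ :=
  sSup {e : ℝ | ∃ f : ℝ → ℝ, InBall ℓ f ∧ e = |Igauss α f - Q f|}

/-- The n-th minimal worst-case error (univariate). -/
def minErr1 (α ℓ : ℝ) (n : ℕ) : ℝ :=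
  ⨅ p : (Fin n → ℝ) × (Fin n → ℝ), wce1 α ℓ fun f => ∑ i, p.2 i * f (p.1 i)

/-- The multivariate Gaussian integral functional. -/
def IgaussD {d : ℕ} (α : Fin d → ℝ) (f : (Fin d → ℝ) → ℝ) : ℝ :=
  ∫ x : Fin d → ℝ,
    f x * ∏ i, (Real.sqrt (2 * Real.pi) * α i)⁻¹ * Real.exp (-(x i) ^ 2 / (2 * α i ^ 2))

/-- Membership in the unit ball of the tensor-product Gaussian RKHS H(K_ℓ), ℓ ∈ ℝ^d. -/
def InBallD {d : ℕ} (ℓ : Fin d → ℝ) (f : (Fin d → ℝ) → ℝ) : Prop :=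
  ∃ c : (Fin d → ℕ) → ℝ,
    (∀ x, HasSum (fun m => c m * ∏ i, phi (ℓ i) (m i) (x i)) (f x)) ∧
    Summable (fun m => c m ^ 2) ∧ (∑' m, c m ^ 2) ≤ 1

/-- Worst-case error of a multivariate quadrature functional. -/
def wceD {d : ℕ} (α ℓ : Fin d → ℝ) (Q : ((Fin d → ℝ) → ℝ) → ℝ) : ℝ :=
  sSup {e : ℝ | ∃ f, InBallD ℓ f ∧ e = |IgaussD α f - Q f|}

/-- The N-th minimal worst-case error in dimension d. -/
def minErrD {d : ℕ} (α ℓ : Fin d → ℝ) (N : ℕ) : ℝ :=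
  ⨅ p : (Fin N → (Fin d → ℝ)) × (Fin N → ℝ), wceD α ℓ fun f => ∑ i, p.2 i * f (p.1 i)

/-- The tensor-product scaled Gauss–Hermite rule. -/
def QGHD {d : ℕ} (α ℓ : Fin d → ℝ) (n : Fin d → ℕ)
    (x w : ∀ j, Fin (n j) → ℝ) (f : (Fin d → ℝ) → ℝ) : ℝ :=
  ∑ i : ∀ j, Fin (n j),
    (∏ j, betaP (α j) (ℓ j) / α j * w j (i j) *
        Real.exp (betaP (α j) (ℓ j) ^ 2 * x j (i j) ^ 2 / (2 * ℓ j ^ 2))) *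
      f fun j => betaP (α j) (ℓ j) * x j (i j)

/-- The power function of a finite point set (univariate). -/
def power1 (ℓ : ℝ) (X : Finset ℝ) (x : ℝ) : ℝ :=
  sSup {v : ℝ | ∃ f, InBall ℓ f ∧ (∀ y ∈ X, f y = 0) ∧ v = f x}

/-- Fill distance of X on Ω (univariate). -/
def fillDist1 (X : Finset ℝ) (Ω : Set ℝ) : ℝ :=
  sSup {h : ℝ | ∃ x ∈ Ω, h = sInf {r : ℝ | ∃ y ∈ X, y ∈ Ω ∧ r = |x - y|}}

/-- Euclidean distance on ℝ^d. -/
def eucDist {d : ℕ} (x y : Fin d → ℝ) : ℝ := Real.sqrt (∑ i, (x i - y i) ^ 2)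

/-- The power function of a finite point set in ℝ^d for the isotropic Gaussian kernel. -/
def powerD {d : ℕ} (ℓ : ℝ) (X : Finset (Fin d → ℝ)) (x : Fin d → ℝ) : ℝ :=
  sSup {v : ℝ | ∃ f, InBallD (fun _ => ℓ) f ∧ (∀ y ∈ X, f y = 0) ∧ v = f x}

/-- Fill distance of X on Ω ⊂ ℝ^d (Euclidean). -/
def fillDistD {d : ℕ} (X : Finset (Fin d → ℝ)) (Ω : Set (Fin d → ℝ)) : ℝ :=
  sSup {h : ℝ | ∃ x ∈ Ω, h = sInf {r : ℝ | ∃ y ∈ X, y ∈ Ω ∧ r = eucDist x y}}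

/-- Worst-case error of the optimal-weight (kernel quadrature) rule with nodes X (univariate). -/
def eopt1 (α ℓ : ℝ) (X : Finset ℝ) : ℝ :=
  ⨅ w : ℝ → ℝ, wce1 α ℓ fun f => ∑ y ∈ X, w y * f y

/-- Worst-case error of the optimal-weight rule with nodes X ⊂ ℝ^d. -/
def eoptD {d : ℕ} (α ℓ : Fin d → ℝ) (X : Finset (Fin d → ℝ)) : ℝ :=
  ⨅ w : (Fin d → ℝ) → ℝ, wceD α ℓ fun f => ∑ y ∈ X, w y * f y

/-- The point sets X_k = ∪_{m=1}^k (Y_{k−m+1}^{m,+} ∪ Y_{k−m+1}^{m,−}). -/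
def Xk (Y : ℕ → Finset ℝ) (k : ℕ) : Finset ℝ :=
  (Finset.Icc 1 k).biUnion fun m =>
    ((Y (k - m + 1)).image fun x => x + (m : ℝ) - 1) ∪
      ((Y (k - m + 1)).image fun x => x - (m : ℝ))

/-- Dividing a real polynomial with nonnegative coefficients by a product of monic linear
factors with nonnegative roots leaves a quotient with nonnegative coefficients. -/
lemma exists_eq_prod_X_sub_C_mul_add {ι : Type*} (s : Finset ι) (a : ι → ℝ)
    (ha : ∀ i, 0 ≤ a i) (P : Polynomial ℝ) (hP : ∀ k, 0 ≤ P.coeff k) :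
    ∃ g r : Polynomial ℝ, P = (∏ i ∈ s, (Polynomial.X - Polynomial.C (a i))) * g + r ∧
      (∀ k, 0 ≤ g.coeff k) ∧ r.degree < s.card := by
  classical
  induction s using Finset.induction_on with
  | empty => exact ⟨P, 0, by simp, hP, by simp⟩
  | insert j s hj ih =>
    obtain ⟨g, r, hPgr, hg, hr⟩ := ih
    have hdiv := Polynomial.X_sub_C_mul_divByMonic_eq_sub_modByMonic g (a j)
    rw [Polynomial.modByMonic_X_sub_C_eq_C_eval] at hdiv
    refine ⟨g /ₘ (Polynomial.X - Polynomial.C (a j)),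
      Polynomial.C (g.eval (a j)) * (∏ i ∈ s, (Polynomial.X - Polynomial.C (a i))) + r,
      ?_, fun k => ?_, ?_⟩
    · rw [Finset.prod_insert hj]
      linear_combination hPgr - (∏ i ∈ s, (Polynomial.X - Polynomial.C (a i))) * hdiv
    · rw [Polynomial.coeff_divByMonic_X_sub_C]
      exact Finset.sum_nonneg fun i _ => mul_nonneg (pow_nonneg (ha j) _) (hg i)
    · rw [Finset.card_insert_of_notMem hj]
      have hlt : (s.card : WithBot ℕ) < ((s.card + 1 : ℕ) : WithBot ℕ) := by
        exact_mod_cast Nat.lt_succ_self s.card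
      refine lt_of_le_of_lt (Polynomial.degree_add_le_of_degree_le ?_ hr.le) hlt
      rw [← Polynomial.smul_eq_C_mul]
      refine (Polynomial.degree_smul_le _ _).trans ?_
      rw [Polynomial.degree_prod]
      simp

/-- The Hermite polynomials are alternately even and odd. -/
lemma aeval_neg_hermite (n : ℕ) (t : ℝ) :
    Polynomial.aeval (-t) (Polynomial.hermite n)
      = (-1) ^ n * Polynomial.aeval t (Polynomial.hermite n) := by
  rw [Polynomial.aeval_eq_sum_range, Polynomial.aeval_eq_sum_range, Finset.mul_sum]
  refine Finset.sum_congr rfl fun k _ => ?_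
  rcases Nat.even_or_odd (n + k) with h | h
  · have h1 : (-1 : ℝ) ^ k = (-1) ^ n := by
      have h2 : (-1 : ℝ) ^ n * (-1) ^ k = 1 := by rw [← pow_add, h.neg_one_pow]
      rcases neg_one_pow_eq_or ℝ n with h3 | h3 <;> rw [h3] at h2 ⊢ <;> linarith
    rw [neg_pow, h1]
    simp only [zsmul_eq_mul]
    ring
  · simp [Polynomial.coeff_hermite_of_odd_add h]

/-- A Hermite polynomial with `n` distinct known real roots is their nodal polynomial. -/
lemma aeval_hermite_eq_prod {n : ℕ} {x : Fin n → ℝ} (hx : Function.Injective x)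
    (h0 : ∀ i, Polynomial.aeval (x i) (Polynomial.hermite n) = 0) (t : ℝ) :
    Polynomial.aeval t (Polynomial.hermite n) = ∏ i, (t - x i) := by
  set H : Polynomial ℝ := (Polynomial.hermite n).map (Int.castRingHom ℝ) with hH
  have hmonic : H.Monic := (Polynomial.hermite_monic n).map _
  have hdeg : H.natDegree = n := by
    rw [hH, (Polynomial.hermite_monic n).natDegree_map, Polynomial.natDegree_hermite]
  have heval : ∀ u : ℝ, H.eval u = Polynomial.aeval u (Polynomial.hermite n) := fun u => by
    rw [hH, Polynomial.aeval_def, Polynomial.eval_map]; rfl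
  have hdvd : ∏ i, (Polynomial.X - Polynomial.C (x i)) ∣ H := by
    refine Finset.prod_dvd_of_coprime ?_ fun i _ => ?_
    · exact fun i _ j _ hij => Polynomial.pairwise_coprime_X_sub_C hx hij
    · rw [Polynomial.dvd_iff_isRoot, Polynomial.IsRoot, heval, h0]
  have heq := Polynomial.eq_of_monic_of_dvd_of_natDegree_le
    (Polynomial.monic_prod_of_monic _ _ fun i _ => Polynomial.monic_X_sub_C (x i)) hmonic hdvd
    (by rw [hdeg, Polynomial.natDegree_prod_of_monic _ _
          fun i _ => Polynomial.monic_X_sub_C (x i)]; simp)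
  rw [← heval, heq, Polynomial.eval_prod]
  simp

/-- By symmetry of the Gauss-Hermite nodes, the product of all `t² - xᵢ²` is nonnegative. -/
lemma prod_sq_sub_sq_nonneg {n : ℕ} {x : Fin n → ℝ} (hx : Function.Injective x)
    (h0 : ∀ i, Polynomial.aeval (x i) (Polynomial.hermite n) = 0) (t : ℝ) :
    0 ≤ ∏ i, (t ^ 2 - x i ^ 2) := by
  have h1 := aeval_hermite_eq_prod hx h0 t
  have h2 := aeval_hermite_eq_prod hx h0 (-t)
  rw [aeval_neg_hermite, h1] at h2
  have h3 : ∏ i, (-t - x i) = (-1) ^ n * ∏ i, (t + x i) := by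
    rw [← Fin.prod_const n (-1 : ℝ), ← Finset.prod_mul_distrib]
    exact Finset.prod_congr rfl fun i _ => by ring
  have h4 : ∏ i, (t - x i) = ∏ i, (t + x i) :=
    mul_left_cancel₀ (pow_ne_zero n (by norm_num : (-1 : ℝ) ≠ 0)) (h2.trans h3)
  have h5 : ∏ i, (t ^ 2 - x i ^ 2) = (∏ i, (t - x i)) * ∏ i, (t + x i) := by
    rw [← Finset.prod_mul_distrib]
    exact Finset.prod_congr rfl fun i _ => by ring
  rw [h5, ← h4]
  exact mul_self_nonneg _

lemma integrable_pow_mul_exp_neg_sq_div_two (m : ℕ) :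
    Integrable fun t : ℝ => t ^ m * Real.exp (-t ^ 2 / 2) := by
  have h := integrable_rpow_mul_exp_neg_mul_sq (b := 1 / 2) (by norm_num) (s := (m : ℝ))
    (by have : (0 : ℝ) ≤ m := m.cast_nonneg
        linarith)
  refine h.congr (Filter.Eventually.of_forall fun t => ?_)
  simp only [Real.rpow_natCast]
  ring_nf

lemma integrable_eval_mul_exp_neg_sq_div_two (p : Polynomial ℝ) :
    Integrable fun t : ℝ => p.eval t * Real.exp (-t ^ 2 / 2) := by
  simp_rw [Polynomial.eval_eq_sum_range, Finset.sum_mul, mul_assoc]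
  exact integrable_finsetSum _ fun i _ =>
    (integrable_pow_mul_exp_neg_sq_div_two i).const_mul _

lemma integral_pow_mul_exp_neg_sq_div_two_succ (q : ℕ) :
    ∫ t : ℝ, t ^ (2 * (q + 1)) * Real.exp (-t ^ 2 / 2)
      = (2 * q + 1) * ∫ t : ℝ, t ^ (2 * q) * Real.exp (-t ^ 2 / 2) := by
  have hd : ∀ t : ℝ, HasDerivAt (fun t : ℝ => t ^ (2 * q + 1) * Real.exp (-t ^ 2 / 2))
      ((2 * q + 1) * (t ^ (2 * q) * Real.exp (-t ^ 2 / 2))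
        - t ^ (2 * (q + 1)) * Real.exp (-t ^ 2 / 2)) t := fun t => by
    have h1 : HasDerivAt (fun t : ℝ => -t ^ 2 / 2) (-t) t :=
      (((hasDerivAt_pow 2 t).neg).div_const 2).congr_deriv (by simp; ring)
    refine ((hasDerivAt_pow (2 * q + 1) t).mul h1.exp).congr_deriv ?_
    push_cast
    ring_nf
  have hi := (integrable_pow_mul_exp_neg_sq_div_two (2 * q)).const_mul (2 * (q : ℝ) + 1)
  have hj := integrable_pow_mul_exp_neg_sq_div_two (2 * (q + 1))
  have h := integral_eq_zero_of_hasDerivAt_of_integrable hd (hi.sub hj)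
    (integrable_pow_mul_exp_neg_sq_div_two (2 * q + 1))
  rw [integral_sub hi hj, integral_const_mul] at h
  linarith

/-- The even moments of the standard Gaussian. -/
lemma integral_pow_mul_exp_neg_sq_div_two (q : ℕ) :
    (Real.sqrt (2 * Real.pi))⁻¹ * ∫ t : ℝ, t ^ (2 * q) * Real.exp (-t ^ 2 / 2)
      = Nat.factorial (2 * q) / (2 ^ q * Nat.factorial q) := by
  induction q with
  | zero =>
    have h := integral_gaussian (1 / 2)
    have h2 : ∀ t : ℝ, -(1 / 2) * t ^ 2 = -t ^ 2 / 2 := fun t => by ring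
    simp_rw [h2] at h
    have h3 : Real.pi / (1 / 2) = 2 * Real.pi := by ring
    rw [h3] at h
    have h4 : Real.sqrt (2 * Real.pi) ≠ 0 := by positivity
    simp only [mul_zero, pow_zero, one_mul, h, inv_mul_cancel₀ h4]
    simp
  | succ q ih =>
    rw [integral_pow_mul_exp_neg_sq_div_two_succ, mul_left_comm, ih,
      show 2 * (q + 1) = 2 * q + 1 + 1 by ring, Nat.factorial_succ, Nat.factorial_succ,
      Nat.factorial_succ]
    push_cast
    field_simp
    ring

/-- Gauss-Hermite quadrature underestimates the even Gaussian moments. -/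
lemma IsGaussHermite.sum_pow_le {n : ℕ} (hn : 1 ≤ n) {x w : Fin n → ℝ}
    (hGH : IsGaussHermite n x w) (q : ℕ) :
    ∑ i, w i * x i ^ (2 * q)
      ≤ (Real.sqrt (2 * Real.pi))⁻¹ * ∫ t : ℝ, t ^ (2 * q) * Real.exp (-t ^ 2 / 2) := by
  obtain ⟨hx, h0, -, hexact⟩ := hGH
  obtain ⟨g, r, hgr, hg, hr⟩ := exists_eq_prod_X_sub_C_mul_add Finset.univ (fun i => x i ^ 2)
    (fun i => sq_nonneg _) ((Polynomial.X : Polynomial ℝ) ^ q)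
    (fun k => by rw [Polynomial.coeff_X_pow]; split_ifs <;> norm_num)
  have hpow : ∀ t : ℝ, t ^ (2 * q)
      = (∏ i, (t ^ 2 - x i ^ 2)) * g.eval (t ^ 2) + r.eval (t ^ 2) := fun t => by
    have h := congrArg (Polynomial.eval (t ^ 2)) hgr
    simpa [Polynomial.eval_prod, pow_mul] using h
  have hnode : ∀ i, x i ^ (2 * q) = r.eval (x i ^ 2) := fun i => by
    rw [hpow, Finset.prod_eq_zero (Finset.mem_univ i) (sub_self _), zero_mul, zero_add]
  have hgnonneg : ∀ t : ℝ, 0 ≤ g.eval (t ^ 2) := fun t => by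
    rw [Polynomial.eval_eq_sum_range]
    exact Finset.sum_nonneg fun k _ => mul_nonneg (hg k) (pow_nonneg (sq_nonneg t) k)
  have hreval : ∀ t : ℝ, (r.comp (Polynomial.X ^ 2)).eval t = r.eval (t ^ 2) := fun t => by
    simp
  have hrdeg : (r.comp (Polynomial.X ^ 2)).natDegree ≤ 2 * n - 1 := by
    rw [Polynomial.natDegree_comp, Polynomial.natDegree_X_pow]
    have : r.natDegree < n := by
      rcases eq_or_ne r 0 with rfl | hr0
      · rw [Polynomial.natDegree_zero]; omega
      · exact (Polynomial.natDegree_lt_iff_degree_lt hr0).2 (by simpa using hr)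
    omega
  have hQ := hexact _ hrdeg
  have hintegrand := integrable_eval_mul_exp_neg_sq_div_two (r.comp (Polynomial.X ^ 2))
  simp_rw [hreval] at hQ hintegrand
  simp_rw [hnode]
  rw [hQ]
  refine mul_le_mul_of_nonneg_left ?_ (by positivity)
  refine integral_mono hintegrand (integrable_pow_mul_exp_neg_sq_div_two (2 * q)) fun t => ?_
  refine mul_le_mul_of_nonneg_right ?_ (Real.exp_pos _).le
  rw [hpow t]
  exact le_add_of_nonneg_left (mul_nonneg (prod_sq_sub_sq_nonneg hx h0 t) (hgnonneg t))

lemma betaP_pos {α ℓ : ℝ} (hα : 0 < α) (hℓ : 0 < ℓ) : 0 < betaP α ℓ := by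
  unfold betaP
  positivity

lemma inv_betaP_sq {α ℓ : ℝ} (hα : 0 < α) (hℓ : 0 < ℓ) :
    (betaP α ℓ ^ 2)⁻¹ = (ℓ ^ 2)⁻¹ + (α ^ 2)⁻¹ := by
  rw [betaP, div_pow, Real.sq_sqrt (by positivity)]
  field_simp

lemma Igauss_phi_two_mul {α ℓ : ℝ} (hα : 0 < α) (hℓ : 0 < ℓ) (q : ℕ) :
    Igauss α (phi ℓ (2 * q)) = betaP α ℓ / α * (betaP α ℓ ^ 2 / ℓ ^ 2) ^ q
      / Real.sqrt (Nat.factorial (2 * q))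
      * ((Real.sqrt (2 * Real.pi))⁻¹ * ∫ t : ℝ, t ^ (2 * q) * Real.exp (-t ^ 2 / 2)) := by
  have hb := betaP_pos hα hℓ
  have hb2 := inv_betaP_sq hα hℓ
  set b := betaP α ℓ
  have hsub := Measure.integral_comp_mul_left
    (fun y : ℝ => phi ℓ (2 * q) y * Real.exp (-y ^ 2 / (2 * α ^ 2))) b
  have hintegrand : ∀ t : ℝ, phi ℓ (2 * q) (b * t) * Real.exp (-(b * t) ^ 2 / (2 * α ^ 2))
      = (b ^ 2 / ℓ ^ 2) ^ q / Real.sqrt (Nat.factorial (2 * q))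
        * (t ^ (2 * q) * Real.exp (-t ^ 2 / 2)) := fun t => by
    have hexp : Real.exp (-t ^ 2 / 2) = Real.exp (-(b * t) ^ 2 / (2 * ℓ ^ 2))
        * Real.exp (-(b * t) ^ 2 / (2 * α ^ 2)) := by
      rw [← Real.exp_add]
      congr 1
      have h1 : b ^ 2 * ((ℓ ^ 2)⁻¹ + (α ^ 2)⁻¹) = 1 := by
        rw [← hb2]
        exact mul_inv_cancel₀ (by positivity)
      linear_combination t ^ 2 / 2 * h1
    rw [hexp, phi, mul_pow, div_pow, ← pow_mul, ← pow_mul]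
    ring
  simp_rw [hintegrand] at hsub
  rw [integral_const_mul, abs_of_pos (inv_pos.2 hb), smul_eq_mul] at hsub
  rw [Igauss, (eq_inv_mul_iff_mul_eq₀ hb.ne').1 hsub |>.symm, mul_inv]
  ring

lemma QGH_phi_two_mul {α ℓ : ℝ} {n : ℕ} (x w : Fin n → ℝ) (q : ℕ) :
    QGH α ℓ x w (phi ℓ (2 * q)) = betaP α ℓ / α * (betaP α ℓ ^ 2 / ℓ ^ 2) ^ q
      / Real.sqrt (Nat.factorial (2 * q)) * ∑ i, w i * x i ^ (2 * q) := by
  rw [QGH, mul_div_assoc, mul_assoc, Finset.mul_sum (a := _ / Real.sqrt _)]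
  congr 1
  refine Finset.sum_congr rfl fun i _ => ?_
  have hexp : Real.exp (betaP α ℓ ^ 2 * x i ^ 2 / (2 * ℓ ^ 2))
      * Real.exp (-(betaP α ℓ * x i) ^ 2 / (2 * ℓ ^ 2)) = 1 := by
    rw [← Real.exp_add, Real.exp_eq_one_iff]
    ring
  rw [phi, mul_pow, div_pow, ← pow_mul, ← pow_mul]
  linear_combination w i * (betaP α ℓ ^ (2 * q) * x i ^ (2 * q))
    / (ℓ ^ (2 * q) * Real.sqrt (Nat.factorial (2 * q))) * hexp

lemma inv_Cseq_mul_rpow {q : ℕ} (hq : 1 ≤ q) :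
    (Cseq q)⁻¹ * (q : ℝ) ^ (-(1 / 4 : ℝ))
      = (Real.sqrt (Nat.factorial (2 * q)))⁻¹
        * (Nat.factorial (2 * q) / (2 ^ q * Nat.factorial q)) := by
  have hq0 : (0 : ℝ) < q := by exact_mod_cast hq
  have h1 : (0 : ℝ) < (q : ℝ) ^ (-(1 / 4 : ℝ)) := Real.rpow_pos_of_pos hq0 _
  have hf : (0 : ℝ) < Nat.factorial (2 * q) := by exact_mod_cast Nat.factorial_pos _
  have h2 := Real.sq_sqrt hf.le
  have h3 : 0 < Real.sqrt (Nat.factorial (2 * q)) := Real.sqrt_pos.2 hf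
  rw [Cseq]
  generalize (q : ℝ) ^ (-(1 / 4 : ℝ)) = c at *
  field_simp
  exact h2

/-- error bound of the scaled Gauss–Hermite rule on φ_{ℓ,2q}. -/
theorem stmt3 (α ℓ : ℝ) (hα : 0 < α) (hℓ : 0 < ℓ) (n : ℕ) (hn : 1 ≤ n)
    (x w : Fin n → ℝ) (hGH : IsGaussHermite n x w) (q : ℕ) (hq : 1 ≤ q) :
    |Igauss α (phi ℓ (2 * q)) - QGH α ℓ x w (phi ℓ (2 * q))|
      ≤ (Cseq q)⁻¹ * (betaP α ℓ / α) * (betaP α ℓ ^ 2 / ℓ ^ 2) ^ q *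
          (q : ℝ) ^ (-(1 / 4 : ℝ)) := by
  have hI := integral_pow_mul_exp_neg_sq_div_two q
  have hle := hGH.sum_pow_le hn q
  have hnonneg : 0 ≤ ∑ i, w i * x i ^ (2 * q) := Finset.sum_nonneg fun i _ =>
    mul_nonneg (hGH.2.2.1 i).le ((even_two_mul q).pow_nonneg _)
  have hb := betaP_pos hα hℓ
  rw [Igauss_phi_two_mul hα hℓ, QGH_phi_two_mul, ← mul_sub, abs_mul, abs_of_nonneg (by positivity),
    abs_of_nonneg (sub_nonneg.2 hle)]
  refine (mul_le_mul_of_nonneg_left (sub_le_self _ hnonneg) (by positivity)).trans_eq ?_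
  rw [hI]
  linear_combination -(betaP α ℓ / α * (betaP α ℓ ^ 2 / ℓ ^ 2) ^ q) * inv_Cseq_mul_rpow hq

end
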